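/- arXiv:1612.01232 — 2 statements merged into one kernel-verified Lean document; each statement's English description precedes it below -/
import Mathlib

section
/- For every integer j ≥ 1 and every b ∈ [−1/2, 1/2], ∫_{Λ_{−j}} D(λ)·Π(λ)·e^{ibλ} dλ ≠ 0. -/
noncomputable section

def Dfn (l : ℝ) : ℝ := (2 / Real.pi) * (Real.sin (l / 2)) ^ 2 / l ^ 2

def Pifn (p1 p2 : ℝ) (l : ℝ) : ℂ :=
  (((1 - p1) * (1 - p2) : ℝ) : ℂ) /
    ((1 - (p1 : ℂ) * Complex.exp (Complex.I * l)) *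
      (1 - (p2 : ℂ) * Complex.exp (-(Complex.I * l))))

def HLfn (L : ℕ) (l : ℝ) : ℝ :=
  2 * (Real.sin (l / 2)) ^ L *
    ∑ p ∈ Finset.range (L / 2), ((L / 2 - 1 + p).choose p : ℝ) * (Real.cos (l / 2)) ^ (2 * p)

def GLfn (L : ℕ) (l : ℝ) : ℝ := HLfn L (l - Real.pi)

def HjL (j L : ℕ) (l : ℝ) : ℝ :=
  HLfn L (2 ^ (j - 1) * l) * ∏ i ∈ Finset.range (j - 1), GLfn L (2 ^ i * l)

def cL (L : ℕ) : ℝ := ((L - 2).choose (L / 2 - 1) : ℝ) * ((L : ℝ) - 1) / 2 ^ (L - 2)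

def Lam (j : ℤ) : Set ℝ :=
  Set.Ico (-((2 : ℝ) ^ (j + 1) * Real.pi)) (-((2 : ℝ) ^ j * Real.pi)) ∪
    Set.Ioc ((2 : ℝ) ^ j * Real.pi) ((2 : ℝ) ^ (j + 1) * Real.pi)

def tauJ (J : ℕ) : ℝ := ((2 : ℝ) ^ (J + 1))⁻¹

def fJ (R θv : ℕ → ℝ) (J : ℕ) (l : ℝ) : ℂ :=
  ∑ i ∈ Finset.Icc 1 (J + 1),
    ((R i : ℝ) : ℂ) * Complex.exp (-(Complex.I * (θv i : ℝ) * l)) *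
      (Lam ((J : ℤ) - i + 1)).indicator (fun _ => (1 : ℂ)) l

def rhoBar (R θv : ℕ → ℝ) (p1 p2 : ℝ) (j L J : ℕ) (th : ℝ) : ℂ :=
  ∫ l : ℝ, ((Dfn l : ℝ) : ℂ) * ((HjL j L l : ℝ) : ℂ) * Pifn p1 p2 l *
    Complex.exp (Complex.I * ((tauJ J)⁻¹ * th) * l) * fJ R θv J ((tauJ J)⁻¹ * l)

def psiLP (s : ℝ) : ℝ :=
  if s = 0 then 1
  else 2 * (Real.sin (2 * Real.pi * s) / (2 * Real.pi * s)) - Real.sin (Real.pi * s) / (Real.pi * s)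

def psiLPj (j : ℤ) (t : ℝ) : ℝ := (2 : ℝ) ^ ((j : ℝ) / 2) * psiLP ((2 : ℝ) ^ j * t)

lemma one_sub_mul_exp_ne_zero {p : ℝ} (hp : p ∈ Set.Ico (0 : ℝ) 1) (x : ℝ) :
    1 - (p : ℂ) * Complex.exp (Complex.I * x) ≠ 0 := by
  intro h
  have h1 : ‖(p : ℂ) * Complex.exp (Complex.I * x)‖ = 1 := by
    rw [← sub_eq_zero.mp h, norm_one]
  rw [norm_mul, mul_comm Complex.I, Complex.norm_exp_ofReal_mul_I, mul_one, Complex.norm_real,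
    Real.norm_of_nonneg hp.1] at h1
  exact hp.2.ne h1

lemma one_sub_mul_exp_neg_ne_zero {p : ℝ} (hp : p ∈ Set.Ico (0 : ℝ) 1) (x : ℝ) :
    1 - (p : ℂ) * Complex.exp (-(Complex.I * x)) ≠ 0 := by
  simpa using one_sub_mul_exp_ne_zero hp (-x)

/-- The real part of `conj ((1 - p₁ e^{il}) (1 - p₂ e^{-il})) e^{ibl}`. -/
def phaseNumerator (p1 p2 b l : ℝ) : ℝ :=
  (1 + p1 * p2) * Real.cos (b * l) - p1 * Real.cos ((1 - b) * l) - p2 * Real.cos ((1 + b) * l)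

lemma phaseNumerator_eq (p1 p2 b l : ℝ) :
    phaseNumerator p1 p2 b l = (1 - p1) * (1 - p2) * Real.cos (b * l) +
      (p1 * (1 - p2) * (2 * Real.sin (l / 2) * Real.sin ((1 - 2 * b) * l / 2)) +
      p2 * (1 - p1) * (2 * Real.sin (l / 2) * Real.sin ((1 + 2 * b) * l / 2)) +
      p1 * p2 * (2 * Real.cos (b * l) * (1 - Real.cos l))) := by
  have h1 := Real.cos_sub_cos (b * l) ((1 - b) * l)
  have h2 := Real.cos_sub_cos (b * l) ((1 + b) * l)
  have h3 := Real.cos_add_cos ((1 + b) * l) ((1 - b) * l)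
  rw [show (b * l + (1 - b) * l) / 2 = l / 2 by ring,
    show (b * l - (1 - b) * l) / 2 = -((1 - 2 * b) * l / 2) by ring, Real.sin_neg] at h1
  rw [show (b * l + (1 + b) * l) / 2 = (1 + 2 * b) * l / 2 by ring,
    show (b * l - (1 + b) * l) / 2 = -(l / 2) by ring, Real.sin_neg] at h2
  rw [show ((1 + b) * l + (1 - b) * l) / 2 = l by ring,
    show ((1 + b) * l - (1 - b) * l) / 2 = b * l by ring] at h3
  unfold phaseNumerator
  linear_combination p1 * (1 - p2) * h1 + p2 * (1 - p1) * h2 - p1 * p2 * h3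

lemma le_phaseNumerator {p1 p2 b l : ℝ} (hp1 : p1 ∈ Set.Ico (0 : ℝ) 1)
    (hp2 : p2 ∈ Set.Ico (0 : ℝ) 1) (hb : b ∈ Set.Icc (-(1 / 2) : ℝ) (1 / 2))
    (h0 : 0 ≤ l) (hl : l ≤ Real.pi) :
    (1 - p1) * (1 - p2) * Real.cos (b * l) ≤ phaseNumerator p1 p2 b l := by
  obtain ⟨hp10, hp11⟩ := hp1
  obtain ⟨hp20, hp21⟩ := hp2
  obtain ⟨hb0, hb1⟩ := hb
  have hc : 0 ≤ Real.cos (b * l) := Real.cos_nonneg_of_neg_pi_div_two_le_of_le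
    (by nlinarith) (by nlinarith)
  have hs : 0 ≤ Real.sin (l / 2) := Real.sin_nonneg_of_nonneg_of_le_pi
    (by linarith) (by linarith)
  have hs1 : 0 ≤ Real.sin ((1 - 2 * b) * l / 2) := Real.sin_nonneg_of_nonneg_of_le_pi
    (by nlinarith) (by nlinarith)
  have hs2 : 0 ≤ Real.sin ((1 + 2 * b) * l / 2) := Real.sin_nonneg_of_nonneg_of_le_pi
    (by nlinarith) (by nlinarith)
  have hc1 : 0 ≤ 1 - Real.cos l := sub_nonneg.mpr (Real.cos_le_one l)
  have hq1 : 0 ≤ 1 - p1 := by linarith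
  have hq2 : 0 ≤ 1 - p2 := by linarith
  rw [phaseNumerator_eq]
  exact le_add_of_nonneg_right (by positivity)

lemma phaseNumerator_neg (p1 p2 b l : ℝ) :
    phaseNumerator p1 p2 b (-l) = phaseNumerator p1 p2 b l := by
  simp [phaseNumerator]

lemma phaseNumerator_nonneg {p1 p2 b l : ℝ} (hp1 : p1 ∈ Set.Ico (0 : ℝ) 1)
    (hp2 : p2 ∈ Set.Ico (0 : ℝ) 1) (hb : b ∈ Set.Icc (-(1 / 2) : ℝ) (1 / 2))
    (hl : |l| ≤ Real.pi) : 0 ≤ phaseNumerator p1 p2 b l := by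
  have habs : phaseNumerator p1 p2 b |l| = phaseNumerator p1 p2 b l := by
    rcases abs_choice l with h | h <;> simp [h, phaseNumerator_neg]
  rw [← habs]
  have hc : 0 ≤ Real.cos (b * |l|) := Real.cos_nonneg_of_neg_pi_div_two_le_of_le
    (by nlinarith [hb.1, abs_nonneg l]) (by nlinarith [hb.2, abs_nonneg l])
  exact (mul_nonneg (mul_nonneg (sub_nonneg.mpr hp1.2.le) (sub_nonneg.mpr hp2.2.le)) hc).trans
    (le_phaseNumerator hp1 hp2 hb (abs_nonneg l) hl)

lemma phaseNumerator_pos {p1 p2 b l : ℝ} (hp1 : p1 ∈ Set.Ico (0 : ℝ) 1)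
    (hp2 : p2 ∈ Set.Ico (0 : ℝ) 1) (hb : b ∈ Set.Icc (-(1 / 2) : ℝ) (1 / 2))
    (h0 : 0 ≤ l) (hl : l < Real.pi) : 0 < phaseNumerator p1 p2 b l := by
  have hc : 0 < Real.cos (b * l) := Real.cos_pos_of_mem_Ioo
    ⟨by nlinarith [hb.1], by nlinarith [hb.2]⟩
  exact (mul_pos (mul_pos (sub_pos.mpr hp1.2) (sub_pos.mpr hp2.2)) hc).trans_le
    (le_phaseNumerator hp1 hp2 hb h0 hl.le)

lemma re_Dfn_mul_Pifn_mul_exp (p1 p2 b l : ℝ) :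
    (((Dfn l : ℝ) : ℂ) * Pifn p1 p2 l * Complex.exp (Complex.I * b * l)).re =
      Dfn l * ((1 - p1) * (1 - p2)) * phaseNumerator p1 p2 b l /
        Complex.normSq ((1 - (p1 : ℂ) * Complex.exp (Complex.I * l)) *
          (1 - (p2 : ℂ) * Complex.exp (-(Complex.I * l)))) := by
  have e1 : Complex.exp (Complex.I * l) = ⟨Real.cos l, Real.sin l⟩ := by
    apply Complex.ext <;> simp [Complex.exp_re, Complex.exp_im]
  have e2 : Complex.exp (-(Complex.I * l)) = ⟨Real.cos l, -Real.sin l⟩ := by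
    apply Complex.ext <;> simp [Complex.exp_re, Complex.exp_im]
  have e3 : Complex.exp (Complex.I * b * l) = ⟨Real.cos (b * l), Real.sin (b * l)⟩ := by
    apply Complex.ext <;> simp [Complex.exp_re, Complex.exp_im]
  have hsq := Real.sin_sq_add_cos_sq l
  unfold Pifn phaseNumerator
  rw [div_eq_mul_inv, Complex.inv_def, e1, e2, e3, sub_mul 1 b l, add_mul 1 b l,
    one_mul l, Real.cos_sub, Real.cos_add]
  generalize Complex.normSq _ = N
  simp only [Complex.mul_re, Complex.mul_im, Complex.ofReal_re, Complex.ofReal_im,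
    Complex.conj_re, Complex.conj_im, Complex.sub_re, Complex.sub_im, Complex.one_re,
    Complex.one_im, zero_mul, div_eq_mul_inv]
  linear_combination (Dfn l * ((1 - p1) * (1 - p2)) * N⁻¹ * p1 * p2 * Real.cos (b * l)) * hsq

lemma Dfn_nonneg (l : ℝ) : 0 ≤ Dfn l := by
  unfold Dfn
  positivity

lemma Dfn_pos {l : ℝ} (h0 : 0 < l) (hl : l < Real.pi) : 0 < Dfn l := by
  have hs : 0 < Real.sin (l / 2) := Real.sin_pos_of_pos_of_lt_pi (by linarith) (by linarith)
  unfold Dfn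
  positivity

lemma continuousOn_Dfn_mul_Pifn_mul_exp {p1 p2 : ℝ} (hp1 : p1 ∈ Set.Ico (0 : ℝ) 1)
    (hp2 : p2 ∈ Set.Ico (0 : ℝ) 1) (b : ℝ) :
    ContinuousOn (fun l : ℝ =>
      ((Dfn l : ℝ) : ℂ) * Pifn p1 p2 l * Complex.exp (Complex.I * b * l)) {0}ᶜ := by
  have hD : ContinuousOn Dfn {0}ᶜ := by
    unfold Dfn
    exact ContinuousOn.div (by fun_prop) (by fun_prop) fun l hl => pow_ne_zero 2 hl
  have hP : Continuous (Pifn p1 p2) := by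
    unfold Pifn
    exact Continuous.div (by fun_prop) (by fun_prop) fun l =>
      mul_ne_zero (one_sub_mul_exp_ne_zero hp1 l) (one_sub_mul_exp_neg_ne_zero hp2 l)
  exact ((Complex.continuous_ofReal.comp_continuousOn hD).mul hP.continuousOn).mul (by fun_prop)

lemma measurableSet_Lam (j : ℤ) : MeasurableSet (Lam j) :=
  measurableSet_Ico.union measurableSet_Ioc

lemma integrableOn_Lam_of_continuousOn {f : ℝ → ℂ} (hf : ContinuousOn f {0}ᶜ) (j : ℤ) :
    MeasureTheory.IntegrableOn f (Lam j) := by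
  have ha : 0 < (2 : ℝ) ^ j * Real.pi := by positivity
  refine MeasureTheory.IntegrableOn.union ?_ ?_
  · refine (ContinuousOn.integrableOn_Icc (hf.mono ?_)).mono_set Set.Ico_subset_Icc_self
    rintro x ⟨-, hx⟩ rfl
    linarith
  · refine (ContinuousOn.integrableOn_Icc (hf.mono ?_)).mono_set Set.Ioc_subset_Icc_self
    rintro x ⟨hx, -⟩ rfl
    linarith

lemma abs_le_of_mem_Lam {j : ℤ} {l : ℝ} (hl : l ∈ Lam j) : |l| ≤ 2 ^ (j + 1) * Real.pi := by
  have ha : 0 < (2 : ℝ) ^ j * Real.pi := by positivity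
  have hb : 0 < (2 : ℝ) ^ (j + 1) * Real.pi := by positivity
  rw [abs_le]
  rcases hl with ⟨h1, h2⟩ | ⟨h1, h2⟩ <;> constructor <;> linarith

theorem statement11
    (p1 p2 : ℝ) (hp1 : p1 ∈ Set.Ico (0 : ℝ) 1) (hp2 : p2 ∈ Set.Ico (0 : ℝ) 1)
    (j : ℕ) (hj : 1 ≤ j) (b : ℝ) (hb : b ∈ Set.Icc (-(1 / 2) : ℝ) (1 / 2)) :
    (∫ l in Lam (-(j : ℤ)),
        ((Dfn l : ℝ) : ℂ) * Pifn p1 p2 l * Complex.exp (Complex.I * b * l)) ≠ 0 := by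
  have hle : (2 : ℝ) ^ (-(j : ℤ) + 1) * Real.pi ≤ Real.pi :=
    mul_le_of_le_one_left Real.pi_pos.le (zpow_le_one_of_nonpos₀ one_le_two (by omega))
  have ha : 0 < (2 : ℝ) ^ (-(j : ℤ)) * Real.pi := by positivity
  have hlt : (2 : ℝ) ^ (-(j : ℤ)) * Real.pi < 2 ^ (-(j : ℤ) + 1) * Real.pi := by
    rw [zpow_add_one₀ two_ne_zero]
    linarith
  have hint := integrableOn_Lam_of_continuousOn
    (continuousOn_Dfn_mul_Pifn_mul_exp hp1 hp2 b) (-(j : ℤ))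
  have hq : 0 < (1 - p1) * (1 - p2) := mul_pos (sub_pos.mpr hp1.2) (sub_pos.mpr hp2.2)
  suffices h : 0 < (∫ l in Lam (-(j : ℤ)),
      ((Dfn l : ℝ) : ℂ) * Pifn p1 p2 l * Complex.exp (Complex.I * b * l)).re by
    intro h0
    simp [h0] at h
  rw [← RCLike.re_eq_complex_re, ← integral_re hint]
  refine (MeasureTheory.setIntegral_pos_iff_support_of_nonneg_ae ?_ hint.re).mpr ?_
  · refine (MeasureTheory.ae_restrict_iff' (measurableSet_Lam _)).mpr (.of_forall fun l hl => ?_)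
    simp only [Pi.zero_apply, RCLike.re_eq_complex_re, re_Dfn_mul_Pifn_mul_exp]
    exact div_nonneg (mul_nonneg (mul_nonneg (Dfn_nonneg l) hq.le)
      (phaseNumerator_nonneg hp1 hp2 hb ((abs_le_of_mem_Lam hl).trans hle)))
      (Complex.normSq_nonneg _)
  · refine lt_of_lt_of_le ?_ (MeasureTheory.measure_mono (s := Set.Ioo
      ((2 : ℝ) ^ (-(j : ℤ)) * Real.pi) (2 ^ (-(j : ℤ) + 1) * Real.pi)) fun l hl => ⟨?_, ?_⟩)
    · simpa using hlt
    · have h0 : 0 < l := ha.trans hl.1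
      have hpi : l < Real.pi := hl.2.trans_le hle
      simp only [Function.mem_support, RCLike.re_eq_complex_re, re_Dfn_mul_Pifn_mul_exp]
      exact (div_pos (mul_pos (mul_pos (Dfn_pos h0 hpi) hq)
        (phaseNumerator_pos hp1 hp2 hb h0.le hpi)) (Complex.normSq_pos.mpr
          (mul_ne_zero (one_sub_mul_exp_ne_zero hp1 l) (one_sub_mul_exp_neg_ne_zero hp2 l)))).ne'
    · exact Or.inr ⟨hl.1, hl.2.le⟩

end
end

section
/- For every even positive integer L and every λ ∈ ℝ, (d/dλ) G_L(λ) = −C(L−2, L/2−1)·((L−1)/2^{L−2})·sin^{L−1}(λ); equivalently, |(d/dλ) G_L(λ)| ≤ c_L and |(d/dλ) H_L(λ)| ≤ c_L for all λ. -/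
noncomputable section

lemma hasDerivAt_one_sub_pow_mul_sum_choose (m K : ℕ) (x : ℝ) :
    HasDerivAt (fun y : ℝ ↦ (1 - y) ^ (m + 1) *
        ∑ p ∈ Finset.range K, ((m + p).choose p : ℝ) * y ^ p)
      (-((K : ℝ) * ((m + K).choose K : ℝ)) * x ^ (K - 1) * (1 - x) ^ m) x := by
  induction K with
  | zero => simpa using hasDerivAt_const x (0 : ℝ)
  | succ K ih =>
    have hpow : HasDerivAt (fun y : ℝ ↦ (1 - y) ^ (m + 1)) (-((m + 1 : ℝ) * (1 - x) ^ m)) x := by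
      refine (((hasDerivAt_id x).const_sub 1).pow (m + 1)).congr_deriv ?_
      simp
    have hterm := hpow.mul ((hasDerivAt_pow K x).const_mul ((m + K).choose K : ℝ))
    refine ((ih.add hterm).congr_deriv ?_).congr_of_eventuallyEq (.of_forall fun y ↦ ?_)
    · have hchoose : ((K : ℝ) + 1) * ((m + (K + 1)).choose (K + 1) : ℝ) =
          ((m : ℝ) + K + 1) * ((m + K).choose K : ℝ) := by
        have h := Nat.add_one_mul_choose_eq (m + K) K
        rw [← add_assoc m K 1, mul_comm]
        exact_mod_cast h.symm
      have hx : (K : ℝ) * x ^ K = K * x ^ (K - 1) * x := by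
        cases K with
        | zero => simp
        | succ k => simp [pow_succ, mul_assoc]
      push_cast
      rw [hchoose]
      linear_combination ((m + K).choose K : ℝ) * (1 - x) ^ m * hx
    · simp only [Finset.sum_range_succ, mul_add, Pi.add_apply, Pi.mul_apply]

lemma HLfn_two_mul_add_two (m : ℕ) (l : ℝ) :
    HLfn (2 * m + 2) l = 2 * ((1 - Real.cos (l / 2) ^ 2) ^ (m + 1) *
      ∑ p ∈ Finset.range (m + 1), ((m + p).choose p : ℝ) * (Real.cos (l / 2) ^ 2) ^ p) := by
  have h : (2 * m + 2) / 2 = m + 1 := by lia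
  rw [HLfn, h, ← Real.sin_sq, ← pow_mul, mul_assoc, mul_add_one]
  simp only [Nat.add_sub_cancel, pow_mul]

lemma hasDerivAt_HLfn (m : ℕ) (l : ℝ) :
    HasDerivAt (HLfn (2 * m + 2))
      (((2 * m).choose m : ℝ) * ((2 * (m : ℝ) + 1) / 2 ^ (2 * m)) * Real.sin l ^ (2 * m + 1)) l := by
  have hcos : HasDerivAt (fun t : ℝ ↦ Real.cos (t / 2) ^ 2)
      (-(Real.sin (l / 2) * Real.cos (l / 2))) l := by
    refine (((hasDerivAt_id l).div_const 2).cos.pow 2).congr_deriv ?_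
    simp only [id]
    push_cast
    ring
  have h := ((hasDerivAt_one_sub_pow_mul_sum_choose m (m + 1) _).comp l hcos).const_mul 2
  refine (h.congr_deriv ?_).congr_of_eventuallyEq (.of_forall (HLfn_two_mul_add_two m))
  have hchoose : ((m : ℝ) + 1) * ((m + (m + 1)).choose (m + 1) : ℝ) =
      (2 * (m : ℝ) + 1) * ((2 * m).choose m : ℝ) := by
    have h := Nat.add_one_mul_choose_eq (2 * m) m
    rw [← add_assoc, ← two_mul, mul_comm]
    exact_mod_cast h.symm
  have hsin : Real.sin l = 2 * Real.sin (l / 2) * Real.cos (l / 2) := by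
    rw [← Real.sin_two_mul, mul_div_cancel₀ l two_ne_zero]
  push_cast
  rw [hchoose, hsin, ← Real.sin_sq]
  field_simp
  ring

lemma hasDerivAt_GLfn (m : ℕ) (l : ℝ) :
    HasDerivAt (GLfn (2 * m + 2))
      (-(((2 * m).choose m : ℝ) * ((2 * (m : ℝ) + 1) / 2 ^ (2 * m))) *
        Real.sin l ^ (2 * m + 1)) l := by
  refine ((hasDerivAt_HLfn m (l - Real.pi)).comp_sub_const l Real.pi).congr_deriv ?_
  rw [Real.sin_sub_pi, Odd.neg_pow ⟨m, rfl⟩]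
  ring

lemma abs_mul_sin_pow_le {c : ℝ} (hc : 0 ≤ c) (n : ℕ) (l : ℝ) :
    |c * Real.sin l ^ n| ≤ c := by
  rw [abs_mul, abs_pow, abs_of_nonneg hc]
  exact mul_le_of_le_one_right hc (pow_le_one₀ (abs_nonneg _) (Real.abs_sin_le_one l))

theorem statement16 (L : ℕ) (hLeven : Even L) (hLpos : 0 < L) (l : ℝ) :
    deriv (GLfn L) l =
      -(((L - 2).choose (L / 2 - 1) : ℝ) * (((L : ℝ) - 1) / 2 ^ (L - 2))) *
        Real.sin l ^ (L - 1) ∧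
    |deriv (GLfn L) l| ≤ cL L ∧ |deriv (HLfn L) l| ≤ cL L := by
  obtain ⟨m, rfl⟩ : ∃ m, L = 2 * m + 2 := by
    obtain ⟨k, rfl⟩ := hLeven
    exact ⟨k - 1, by lia⟩
  have hhalf : (2 * m + 2) / 2 - 1 = m := by lia
  have hpred : 2 * m + 2 - 1 = 2 * m + 1 := by lia
  have hcast : ((2 * m + 2 : ℕ) : ℝ) - 1 = 2 * m + 1 := by push_cast; ring
  have hc : (0 : ℝ) ≤ ((2 * m).choose m : ℝ) * ((2 * (m : ℝ) + 1) / 2 ^ (2 * m)) := by positivity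
  rw [cL, (hasDerivAt_GLfn m l).deriv, (hasDerivAt_HLfn m l).deriv, hhalf, hpred, hcast,
    Nat.add_sub_cancel, mul_div_assoc]
  refine ⟨rfl, ?_, abs_mul_sin_pow_le hc _ l⟩
  rw [neg_mul, abs_neg]
  exact abs_mul_sin_pow_le hc _ l

end
end
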